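/- In a minimal counterexample (G, S, R, v, P_k(v), Q, k) to the Extension Theorem in which additionally every vertex of R is incident to fewer than 2k self-loops, the set S ∪ R is (Q−4)k-edge-connected in G. -/

import Mathlib

/-!
Multigraphs are modelled by a vertex type `V`, an edge type `E`, and an
incidence map `ends : E → Sym2 V` giving the (unordered) pair of endpoints
of each edge.  Subgraphs are identified with their edge sets (`Set E`).
-/

namespace SteinerPacking

variable {V E : Type}

/-- The set of edges incident to a vertex `u` (denoted `E(u)` in the paper). -/
def incEdges (ends : E → Sym2 V) (u : V) : Set E := {e | u ∈ ends e}

/-- The degree `d(u) = |E(u)|` of a vertex. -/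
noncomputable def deg (ends : E → Sym2 V) (u : V) : ℕ := (incEdges ends u).ncard

/-- One step along an edge of the edge set `F`. -/
def Step (ends : E → Sym2 V) (F : Set E) (a b : V) : Prop := ∃ e ∈ F, ends e = s(a, b)

/-- `a` and `b` are joined by a walk using only edges in `F`. -/
def Reaches (ends : E → Sym2 V) (F : Set E) (a b : V) : Prop :=
  Relation.ReflTransGen (Step ends F) a b

/-- The vertex set `S` is connected in the subgraph with edge set `F`. -/
def ConnectsSet (ends : E → Sym2 V) (F : Set E) (S : Set V) : Prop :=
  ∀ a ∈ S, ∀ b ∈ S, Reaches ends F a b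

/-- A walk from `u` to `w` given by a list of edges. -/
inductive IsWalk (ends : E → Sym2 V) : V → V → List E → Prop
  | nil (v : V) : IsWalk ends v v []
  | cons {u v w : V} {e : E} {l : List E} :
      ends e = s(u, v) → IsWalk ends v w l → IsWalk ends u w (e :: l)

/-- A path from `u` to `v` using edges of `F` (a walk with no repeated edges). -/
def IsPathIn (ends : E → Sym2 V) (F : Set E) (u v : V) (l : List E) : Prop :=
  IsWalk ends u v l ∧ l.Nodup ∧ ∀ e ∈ l, e ∈ F

/-- There are `n` pairwise edge-disjoint paths from `u` to `v` inside `F`. -/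
def EdgeDisjointPathsIn (ends : E → Sym2 V) (F : Set E) (n : ℕ) (u v : V) : Prop :=
  ∃ P : Fin n → List E, (∀ i, IsPathIn ends F u v (P i)) ∧
    ∀ i j, i ≠ j → ∀ e ∈ P i, e ∉ P j

/-- `S` is `n`-edge-connected in the (sub)graph with edge set `F`:
any two distinct vertices of `S` are joined by `n` edge-disjoint paths. -/
def EdgeConnectedIn (ends : E → Sym2 V) (F : Set E) (S : Set V) (n : ℕ) : Prop :=
  ∀ a ∈ S, ∀ b ∈ S, a ≠ b → EdgeDisjointPathsIn ends F n a b

/-- A family of subgraphs (edge sets) is pairwise edge-disjoint. -/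
def PairwiseEdgeDisjoint {k : ℕ} (H : Fin k → Set E) : Prop :=
  ∀ i j, i ≠ j → Disjoint (H i) (H j)

/-- `v` is a cut vertex of the subgraph with edge set `H`: some two vertices
distinct from `v` are connected in `H` but not after removing `v`. -/
def IsCutVertexOf (ends : E → Sym2 V) (H : Set E) (v : V) : Prop :=
  ∃ a b : V, a ≠ v ∧ b ≠ v ∧ Reaches ends H a b ∧
    ¬ Reaches ends {e ∈ H | v ∉ ends e} a b

/-- A subpartition of `E(v)` into `k` (possibly empty) parts. -/
def IsSubpartitionAt {k : ℕ} (ends : E → Sym2 V) (v : V) (P : Fin k → Set E) : Prop :=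
  (∀ i, P i ⊆ incEdges ends v) ∧ ∀ i j, i ≠ j → Disjoint (P i) (P j)

/-- A balanced partition of `E(v)` into `k` parts: each part has ≥ 2 edges. -/
def IsBalancedPartitionAt {k : ℕ} (ends : E → Sym2 V) (v : V) (P : Fin k → Set E) : Prop :=
  IsSubpartitionAt ends v P ∧ (⋃ i, P i) = incEdges ends v ∧ ∀ i, 2 ≤ (P i).ncard

/-- A balanced subpartition of `E(v)`: one extendable to a balanced partition. -/
def IsBalancedSubpartitionAt {k : ℕ} (ends : E → Sym2 V) (v : V) (P : Fin k → Set E) : Prop :=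
  IsSubpartitionAt ends v P ∧
    ∃ P' : Fin k → Set E, IsBalancedPartitionAt ends v P' ∧ ∀ i, P i ⊆ P' i

/-- The subgraphs `H 1, …, H k` extend the subpartition `P` at `v`:
`P i ⊆ H i` and `v` is not a cut vertex of any `H i`. -/
def Extend {k : ℕ} (ends : E → Sym2 V) (v : V) (P H : Fin k → Set E) : Prop :=
  ∀ i, P i ⊆ H i ∧ ¬ IsCutVertexOf ends (H i) v

/-- The subgraphs `H 1, …, H k` balance the vertex `u`. -/
def BalanceVertex {k : ℕ} (ends : E → Sym2 V) (H : Fin k → Set E) (u : V) : Prop :=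
  IsBalancedSubpartitionAt ends u (fun i => incEdges ends u ∩ H i)

/-- The subgraphs `H 1, …, H k` balance every vertex of `T`. -/
def BalanceSet {k : ℕ} (ends : E → Sym2 V) (H : Fin k → Set E) (T : Set V) : Prop :=
  ∀ u ∈ T, BalanceVertex ends H u

/-- A loopless multigraph. -/
def Loopless (ends : E → Sym2 V) : Prop := ∀ e : E, ¬ (ends e).IsDiag

/-- The set of neighbors of a vertex. -/
def neighbors (ends : E → Sym2 V) (u : V) : Set V := {w | ∃ e, ends e = s(u, w)}

/-- There is no family of `k` pairwise edge-disjoint `S`-subgraphs that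
balance `S ∪ R` and extend the subpartition `P` at `v`. -/
def NoGoodPacking {k : ℕ} (ends : E → Sym2 V) (S R : Set V) (v : V)
    (P : Fin k → Set E) : Prop :=
  ¬ ∃ H : Fin k → Set E, PairwiseEdgeDisjoint H ∧ (∀ i, ConnectsSet ends (H i) S) ∧
      BalanceSet ends H (S ∪ R) ∧ Extend ends v P H

/-- `(G, S, R, v, P, Q, k)` is a counterexample to the Extension Theorem:
it satisfies all hypotheses of the Extension Theorem (including that every
label appears at least twice at `v`), yet admits no good packing. -/
def ExtCex (Q k : ℕ) (ends : E → Sym2 V) (S R : Set V) (v : V)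
    (P : Fin k → Set E) : Prop :=
  36 ≤ Q ∧ 0 < k ∧ Disjoint S R ∧ 2 ≤ S.ncard ∧
  EdgeConnectedIn ends Set.univ S (Q * k) ∧
  (∀ r ∈ R, (Q - 2) * k ≤ deg ends r) ∧
  v ∈ S ∧ (∀ e : E, v ∈ ends e → ¬ (ends e).IsDiag) ∧
  deg ends v = Q * k ∧
  IsBalancedSubpartitionAt ends v P ∧ (∀ i, 2 ≤ (P i).ncard) ∧
  NoGoodPacking ends S R v P

/-- The measure used for minimality: number of vertices plus number of
non-loop edges. -/
noncomputable def extMeasure (ends : E → Sym2 V) : ℕ :=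
  Nat.card V + {e : E | ¬ (ends e).IsDiag}.ncard

/-- A minimal counterexample to the Extension Theorem: a counterexample whose
measure is at most the measure of every counterexample (with the same `Q`, `k`). -/
def MinExtCex (Q k : ℕ) (ends : E → Sym2 V) (S R : Set V) (v : V)
    (P : Fin k → Set E) : Prop :=
  ExtCex Q k ends S R v P ∧
  ∀ (V' E' : Type) (_ : Finite V') (_ : Finite E') (ends' : E' → Sym2 V')
    (S' R' : Set V') (v' : V') (P' : Fin k → Set E'),
    ExtCex Q k ends' S' R' v' P' → extMeasure ends ≤ extMeasure ends'

/-- The edges with exactly one end in `Z`. -/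
def cutEdges (ends : E → Sym2 V) (Z : Set V) : Set E :=
  {e | ∃ a ∈ Z, ∃ b ∉ Z, ends e = s(a, b)}

/-- A walk from a vertex to the target set `T`, recorded as a list of oriented edges
`(edge, tail, head)`, that stops as soon as it meets `T`. -/
inductive IsDartWalk (ends : E → Sym2 V) (T : Set V) : V → List (E × V × V) → Prop
  | nil {t : V} : t ∈ T → IsDartWalk ends T t []
  | cons {a b : V} {e : E} {l : List (E × V × V)} :
      ends e = s(a, b) → a ∉ T → IsDartWalk ends T b l → IsDartWalk ends T a ((e, a, b) :: l)

/-- Every point is either fixed (and satisfies `p`) or its head matches its image's source. -/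
def IsLinking {I : Type} (hd : I → V) (src : I → Set V) (p : I → Prop) (φ : Equiv.Perm I) : Prop :=
  ∀ x, (φ x = x ∧ p x) ∨ hd x ∈ src (φ x)

theorem IsLinking.redirect {I : Type} {hd : I → V} {src : I → Set V} {p : I → Prop}
    {φ : Equiv.Perm I} (hφ : IsLinking hd src p φ) {d d' : I}
    (hd1 : φ d ≠ d) (hd2 : φ d' ≠ d') (hsrc : src d' = {hd d}) :
    ∃ ψ : Equiv.Perm I, IsLinking hd src p ψ ∧ ψ d = d' ∧
      ∀ a, a ≠ d → φ a ≠ d' → ψ a = φ a := by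
  classical
  refine ⟨φ * Equiv.swap d (φ.symm d'), ?_, by simp, ?_⟩
  · intro x
    by_cases hx : x = d
    · subst hx
      right
      simp [hsrc]
    by_cases hz : x = φ.symm d'
    · right
      have hφx : φ x = d' := by simp [hz]
      have h1 : hd x = hd d := by
        rcases hφ x with ⟨h, -⟩ | h
        · exact absurd (by rw [← hφx, h, h]) hd2
        · simpa [hφx, hsrc] using h
      rcases hφ d with ⟨h, -⟩ | h
      · exact absurd h hd1
      · rw [← hz]
        simpa [h1] using h
    · simpa [Equiv.swap_apply_of_ne_of_ne hx hz] using hφ x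
  · intro a ha ha'
    have : a ≠ φ.symm d' := by
      rintro rfl
      simp at ha'
    simp [Equiv.swap_apply_of_ne_of_ne ha this]

theorem IsLinking.fix_antiparallel {I : Type} {hd : I → V} {src : I → Set V} {p : I → Prop}
    {φ : Equiv.Perm I} (hφ : IsLinking hd src p φ) {d d' : I} (hp : p d) (hp' : p d')
    (hne : d ≠ d') (hd1 : φ d ≠ d) (hd2 : φ d' ≠ d')
    (hsrc : src d = {hd d'}) (hsrc' : src d' = {hd d}) :
    ∃ ψ : Equiv.Perm I, IsLinking hd src p ψ ∧ ψ d = d ∧ ∀ a, φ a = a → ψ a = a := by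
  classical
  obtain ⟨ψ, hψ, hψd, hψ'⟩ := hφ.redirect hd1 hd2 hsrc'
  have h1 : ψ d' ≠ d' := fun h => hne (ψ.injective (hψd.trans h.symm))
  have h2 : ψ d ≠ d := by rw [hψd]; exact hne.symm
  obtain ⟨χ, hχ, hχd, hχ'⟩ := hψ.redirect h1 h2 hsrc
  have hχd' : χ d = d' := (hχ' d hne (by rw [hψd]; exact hne.symm)).trans hψd
  refine ⟨χ * Equiv.swap d d', ?_, by simp [hχd], ?_⟩
  · intro x
    by_cases hx : x = d
    · subst hx
      exact Or.inl ⟨by simp [hχd], hp⟩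
    by_cases hx' : x = d'
    · subst hx'
      exact Or.inl ⟨by simp [hχd'], hp'⟩
    · simpa [Equiv.swap_apply_of_ne_of_ne hx hx'] using hχ x
  · intro a ha
    have had : a ≠ d := by rintro rfl; exact hd1 ha
    have had' : a ≠ d' := by rintro rfl; exact hd2 ha
    have e1 : ψ a = a := (hψ' a had (by rwa [ha])).trans ha
    have e2 : χ a = a := (hχ' a had' (by rwa [e1])).trans e1
    simp [Equiv.swap_apply_of_ne_of_ne had had', e2]

theorem IsLinking.exists_no_antiparallel {I : Type} [Finite I] {hd : I → V} {src : I → Set V}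
    {p : I → Prop} {φ : Equiv.Perm I} (hφ : IsLinking hd src p φ) :
    ∃ ψ : Equiv.Perm I, IsLinking hd src p ψ ∧ ∀ d d', p d → p d' → d ≠ d' →
      src d = {hd d'} → src d' = {hd d} → ψ d = d ∨ ψ d' = d' := by
  obtain ⟨ψ, hψ, hmax⟩ := Set.exists_max_image {φ | IsLinking hd src p φ}
    (fun φ => {a | φ a = a}.ncard) (Set.toFinite _) ⟨φ, hφ⟩
  refine ⟨ψ, hψ, fun d d' hp hp' hne h1 h2 => ?_⟩
  by_contra! hcon
  obtain ⟨χ, hχ, hχd, hχ'⟩ := hψ.fix_antiparallel hp hp' hne hcon.1 hcon.2 h1 h2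
  refine (hmax χ hχ).not_gt (Set.ncard_lt_ncard ⟨hχ', fun h => ?_⟩ (Set.toFinite _))
  exact hcon.1 (h hχd)

/-- The oriented non-loop edges that neither enter `s` nor leave `T`. -/
abbrev Dart (ends : E → Sym2 V) (s : V) (T : Set V) : Type :=
  {d : E × V × V // ends d.1 = s(d.2.1, d.2.2) ∧ d.2.1 ≠ d.2.2 ∧ d.2.1 ∉ T ∧ d.2.2 ≠ s}

/-- The head of a dart; tokens end in the source vertex. -/
def dartHead (ends : E → Sym2 V) (s : V) (T : Set V) (n : ℕ) : Fin n ⊕ Dart ends s T → V :=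
  Sum.elim (fun _ => s) (fun d => d.1.2.2)

/-- The possible tails of a dart; tokens start in the target set. -/
def dartTail (ends : E → Sym2 V) (s : V) (T : Set V) (n : ℕ) : Fin n ⊕ Dart ends s T → Set V :=
  Sum.elim (fun _ => T) (fun d => {d.1.2.1})

theorem exists_isLinking [Finite V] [Finite E] (ends : E → Sym2 V) (s : V) (T : Set V)
    (hs : s ∉ T) (n : ℕ)
    (hcut : ∀ Z : Set V, s ∈ Z → Disjoint Z T → n ≤ (cutEdges ends Z).ncard) :
    ∃ φ, IsLinking (dartHead ends s T n) (dartTail ends s T n) (fun x => x.isRight) φ := by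
  classical
  have := Fintype.ofFinite V
  have := Fintype.ofFinite E
  set hd := dartHead ends s T n with hhd
  set src := dartTail ends s T n with hsrc
  let N : Fin n ⊕ Dart ends s T → Finset (Fin n ⊕ Dart ends s T) := fun x =>
    Finset.univ.filter (fun y => (y = x ∧ x.isRight) ∨ hd x ∈ src y)
  have hall : ∀ W : Finset (Fin n ⊕ Dart ends s T), W.card ≤ (W.biUnion N).card := by
    intro W
    by_cases hW : ∃ j, Sum.inl j ∈ W
    · obtain ⟨j, hj⟩ := hW
      have hWcard : W.card ≤ n + W.toRight.card := by
        rw [← Finset.card_toLeft_add_card_toRight]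
        have := Finset.card_le_univ W.toLeft
        simp at this
        omega
      have hdart : ∀ d ∈ W.toRight, Sum.inr d ∈ W.biUnion N := by
        intro d hdW
        exact Finset.mem_biUnion.2 ⟨Sum.inr d, by simpa using hdW, by simp [N]⟩
      by_cases hT : ∃ d ∈ W.toRight, d.1.2.2 ∈ T
      · obtain ⟨d, hdW, hdT⟩ := hT
        have hsub : (Finset.univ : Finset (Fin n)).disjSum W.toRight ⊆ W.biUnion N := by
          intro x hx
          rcases x with i | x
          · exact Finset.mem_biUnion.2 ⟨Sum.inr d, by simpa using hdW,
              by simp [N, hhd, hsrc, dartHead, dartTail, hdT]⟩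
          · exact hdart x (by simpa using hx)
        have := Finset.card_le_card hsub
        simp at this
        omega
      · push Not at hT
        let Z : Set V := {w | w = s ∨ ∃ d ∈ W.toRight, d.1.2.2 = w}
        have hZ : n ≤ (cutEdges ends Z).ncard := by
          refine hcut Z (Or.inl rfl) (Set.disjoint_left.2 ?_)
          rintro w (rfl | ⟨d, hdW, rfl⟩)
          · exact hs
          · exact hT d hdW
        have hZT : ∀ w ∈ Z, w ∉ T := by
          rintro w (rfl | ⟨d, hdW, rfl⟩)
          · exact hs
          · exact hT d hdW
        let C : Finset (Dart ends s T) := Finset.univ.filter (fun d => d.1.2.1 ∈ Z ∧ d.1.2.2 ∉ Z)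
        have hCmem : ∀ c ∈ C, c.1.2.1 ∈ Z ∧ c.1.2.2 ∉ Z := fun c hc => (Finset.mem_filter.1 hc).2
        have hC : (cutEdges ends Z).ncard ≤ C.card := by
          refine le_trans ?_ (Finset.card_image_le (s := C) (f := fun d => d.1.1))
          rw [← Set.ncard_coe_finset]
          refine Set.ncard_le_ncard ?_ (Set.toFinite _)
          rintro e ⟨a, ha, b, hb, hab⟩
          refine Finset.mem_coe.2 (Finset.mem_image.2
            ⟨⟨(e, a, b), hab, fun h => hb ((show a = b from h) ▸ ha), hZT a ha,
              fun h => hb (Or.inl h)⟩, ?_, rfl⟩)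
          exact Finset.mem_filter.2 ⟨Finset.mem_univ _, ha, hb⟩
        have hdisj : Disjoint C W.toRight := by
          rw [Finset.disjoint_left]
          intro c hc hcW
          exact (hCmem c hc).2 (Or.inr ⟨c, hcW, rfl⟩)
        have hsub : (C ∪ W.toRight).map Function.Embedding.inr ⊆ W.biUnion N := by
          intro x hx
          obtain ⟨d, hdC, rfl⟩ := Finset.mem_map.1 hx
          rcases Finset.mem_union.1 hdC with hdC | hdW
          · rcases (hCmem d hdC).1 with h | ⟨d', hd'W, h⟩
            · exact Finset.mem_biUnion.2 ⟨Sum.inl j, hj,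
                by simp [N, hhd, hsrc, dartHead, dartTail, h]⟩
            · exact Finset.mem_biUnion.2 ⟨Sum.inr d', by simpa using hd'W,
                by simp [N, hhd, hsrc, dartHead, dartTail, h]⟩
          · exact hdart d hdW
        have := Finset.card_le_card hsub
        rw [Finset.card_map, Finset.card_union_of_disjoint hdisj] at this
        omega
    · push Not at hW
      refine Finset.card_le_card fun x hx => ?_
      rcases x with j | d
      · exact absurd hx (hW j)
      · exact Finset.mem_biUnion.2 ⟨Sum.inr d, hx, by simp [N]⟩
  obtain ⟨f, hf, hfN⟩ := (Finset.all_card_le_biUnion_card_iff_exists_injective N).1 hall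
  refine ⟨Equiv.ofBijective f (Finite.injective_iff_bijective.1 hf), fun x => ?_⟩
  simpa [N] using hfN x

/-- Menger's theorem for a source vertex and a target set, with oriented walks. -/
theorem exists_dartWalks [Finite V] [Finite E] (ends : E → Sym2 V) (s : V) (T : Set V)
    (hs : s ∉ T) (n : ℕ)
    (hcut : ∀ Z : Set V, s ∈ Z → Disjoint Z T → n ≤ (cutEdges ends Z).ncard) :
    ∃ L : Fin n → List (E × V × V), (∀ j, IsDartWalk ends T s (L j)) ∧
      (((List.finRange n).flatMap L).map Prod.fst).Nodup ∧
      ∀ j, ∀ d ∈ L j, ends d.1 = s(d.2.1, d.2.2) ∧ d.2.1 ≠ d.2.2 ∧ d.2.1 ∉ T ∧ d.2.2 ≠ s := by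
  classical
  obtain ⟨φ₀, hφ₀⟩ := exists_isLinking ends s T hs n hcut
  obtain ⟨φ, hφ, hanti⟩ := hφ₀.exists_no_antiparallel
  have hret : ∀ j : Fin n, ∃ m, 0 < m ∧ ((φ ^ m) (Sum.inl j)).isLeft := fun j =>
    ⟨orderOf φ, orderOf_pos φ, by simp [pow_orderOf_eq_one]⟩
  let m : Fin n → ℕ := fun j => Nat.find (hret j)
  have hm0 : ∀ j, 0 < m j := fun j => (Nat.find_spec (hret j)).1
  have hmL : ∀ j, ((φ ^ m j) (Sum.inl j)).isLeft := fun j => (Nat.find_spec (hret j)).2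
  have hmin : ∀ j k, 0 < k → k < m j → ¬ ((φ ^ k) (Sum.inl j)).isLeft := fun j k hk hkm h =>
    Nat.find_min (hret j) hkm ⟨hk, h⟩
  have hnfix : ∀ j k, 0 < k → k < m j → φ ((φ ^ k) (Sum.inl j)) ≠ (φ ^ k) (Sum.inl j) := by
    intro j k hk hkm h
    have h1 := Equiv.Perm.pow_apply_eq_self_of_apply_eq_self h (m j - k)
    rw [← Equiv.Perm.mul_apply, ← pow_add, Nat.sub_add_cancel hkm.le] at h1
    exact hmin j k hk hkm (h1 ▸ hmL j)
  have hle : ∀ j k j' k', 0 < k → k < m j → 0 < k' → k' < m j' → k ≤ k' →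
      (φ ^ k) (Sum.inl j) = (φ ^ k') (Sum.inl j') → j = j' ∧ k = k' := by
    intro j k j' k' hk hkm hk' hkm' hkk h
    rw [← Nat.add_sub_cancel' hkk, pow_add, Equiv.Perm.mul_apply] at h
    have h := (φ ^ k).injective h
    rcases Nat.eq_zero_or_pos (k' - k) with h0 | h0
    · rw [h0] at h
      exact ⟨by simpa using h, by omega⟩
    · exact absurd (by rw [← h]; rfl) (hmin j' (k' - k) h0 (by omega))
  have huniq : ∀ j k j' k' (d d' : Dart ends s T), 0 < k → k < m j → 0 < k' → k' < m j' →
      (φ ^ k) (Sum.inl j) = Sum.inr d → (φ ^ k') (Sum.inl j') = Sum.inr d' →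
      d.1.1 = d'.1.1 → j = j' ∧ k = k' := by
    intro j k j' k' d d' hk hkm hk' hkm' hd hd' hdd
    by_cases hne : d = d'
    · subst hne
      rcases le_total k k' with h | h
      · exact hle j k j' k' hk hkm hk' hkm' h (hd.trans hd'.symm)
      · have := hle j' k' j k hk' hkm' hk hkm h (hd'.trans hd.symm)
        exact ⟨this.1.symm, this.2.symm⟩
    · exfalso
      obtain ⟨⟨e, a, b⟩, h1, h2, h3, h4⟩ := d
      obtain ⟨⟨e', a', b'⟩, h1', h2', h3', h4'⟩ := d'
      simp only at hdd h1 h1' h2 h2' h3 h3' h4 h4'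
      subst hdd
      have hab : a = b' ∧ b = a' := by
        rcases Sym2.eq_iff.1 (h1.symm.trans h1') with ⟨rfl, rfl⟩ | h
        · exact absurd rfl hne
        · exact h
      obtain ⟨rfl, rfl⟩ := hab
      rcases hanti (Sum.inr ⟨(e, a, b), h1, h2, h3, h4⟩) (Sum.inr ⟨(e, b, a), h1', h2', h3', h4'⟩)
        rfl rfl (fun h => h2 (congrArg (fun d => d.1.2.1) (Sum.inr.inj h))) rfl rfl with h | h
      · exact hnfix j k hk hkm (by rw [hd, h])
      · exact hnfix j' k' hk' hkm' (by rw [hd', h])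
  have hwalk : ∀ j r k, k + r + 1 = m j → ∃ l : List (E × V × V),
      IsDartWalk ends T (dartHead ends s T n ((φ ^ k) (Sum.inl j))) l ∧
      (∀ d ∈ l, ∃ k', k < k' ∧ k' < m j ∧ ∃ D : Dart ends s T,
        (φ ^ k') (Sum.inl j) = Sum.inr D ∧ D.1 = d) ∧ (l.map Prod.fst).Nodup := by
    intro j r
    induction r with
    | zero =>
      intro k hk
      refine ⟨[], IsDartWalk.nil ?_, by simp, by simp⟩
      have hL := hmL j
      rw [← hk, pow_succ', Equiv.Perm.mul_apply] at hL
      obtain ⟨i, hi⟩ := Sum.isLeft_iff.1 hL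
      rcases hφ ((φ ^ k) (Sum.inl j)) with ⟨h, h'⟩ | h
      · rw [← h, hi] at h'
        simp at h'
      · rw [hi] at h
        exact h
    | succ r ih =>
      intro k hk
      obtain ⟨l, hl, hlk, hnd⟩ := ih (k + 1) (by omega)
      have hR := hmin j (k + 1) (by omega) (by omega)
      rw [Sum.not_isLeft, Sum.isRight_iff] at hR
      obtain ⟨D, hD⟩ := hR
      rw [hD] at hl
      have htail : dartHead ends s T n ((φ ^ k) (Sum.inl j)) = D.1.2.1 := by
        have hD' := hD
        rw [pow_succ', Equiv.Perm.mul_apply] at hD'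
        rcases hφ ((φ ^ k) (Sum.inl j)) with ⟨h, -⟩ | h
        · exfalso
          refine hnfix j (k + 1) (by omega) (by omega) ?_
          rw [pow_succ', Equiv.Perm.mul_apply, h, h]
        · rw [hD'] at h
          exact h
      refine ⟨D.1 :: l, ?_, ?_, ?_⟩
      · rw [htail]
        exact IsDartWalk.cons D.2.1 D.2.2.2.1 hl
      · intro d hd
        rcases List.mem_cons.1 hd with rfl | hd
        · exact ⟨k + 1, by omega, by omega, D, hD, rfl⟩
        · obtain ⟨k', h1, h2, h3⟩ := hlk d hd
          exact ⟨k', by omega, h2, h3⟩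
      · rw [List.map_cons, List.nodup_cons]
        refine ⟨fun hmem => ?_, hnd⟩
        obtain ⟨d, hdl, hde⟩ := List.mem_map.1 hmem
        obtain ⟨k', h1, h2, D', hD', rfl⟩ := hlk d hdl
        have := huniq j (k + 1) j k' D D' (by omega) (by omega) (by omega) h2 hD hD' hde.symm
        omega
  choose L hL hLk hLn using fun j => hwalk j (m j - 1) 0 (by have := hm0 j; omega)
  refine ⟨L, fun j => hL j, ?_, ?_⟩
  · rw [List.map_flatMap, List.nodup_flatMap]
    refine ⟨fun j _ => hLn j, (List.nodup_finRange n).pairwise_of_forall_ne ?_⟩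
    intro j _ j' _ hjj e he he'
    obtain ⟨d, hd, rfl⟩ := List.mem_map.1 he
    obtain ⟨d', hd', hdd⟩ := List.mem_map.1 he'
    obtain ⟨k, h1, h2, D, hD, rfl⟩ := hLk j d hd
    obtain ⟨k', h1', h2', D', hD', rfl⟩ := hLk j' d' hd'
    exact hjj (huniq j k j' k' D D' h1 h2 h1' h2' hD hD' hdd.symm).1
  · intro j d hd
    obtain ⟨k, h1, h2, D, hD, rfl⟩ := hLk j d hd
    exact D.2

theorem IsDartWalk.exists_isWalk {ends : E → Sym2 V} {T : Set V} {a : V} {l : List (E × V × V)}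
    (h : IsDartWalk ends T a l) : ∃ t ∈ T, IsWalk ends a t (l.map Prod.fst) := by
  induction h with
  | @nil t ht => exact ⟨t, ht, IsWalk.nil t⟩
  | cons he _ _ ih =>
    obtain ⟨t, ht, hw⟩ := ih
    exact ⟨t, ht, IsWalk.cons he hw⟩

theorem edgeDisjointPathsIn_of_cut [Finite V] [Finite E] (ends : E → Sym2 V) {s t : V} (hst : s ≠ t)
    (n : ℕ) (hcut : ∀ Z : Set V, s ∈ Z → t ∉ Z → n ≤ (cutEdges ends Z).ncard) :
    EdgeDisjointPathsIn ends Set.univ n s t := by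
  obtain ⟨L, hL, hnd, -⟩ := exists_dartWalks ends s {t} (by simpa using hst) n
    (fun Z hs hZ => hcut Z hs (by simpa using hZ))
  rw [List.map_flatMap, List.nodup_flatMap] at hnd
  refine ⟨fun j => (L j).map Prod.fst, fun j => ⟨?_, hnd.1 j (List.mem_finRange j), by simp⟩, ?_⟩
  · obtain ⟨t', ht', hw⟩ := (hL j).exists_isWalk
    rw [Set.mem_singleton_iff] at ht'
    exact ht' ▸ hw
  · intro i j hij e he he'
    have hsymm : Std.Symm (Function.onFun List.Disjoint fun j => (L j).map Prod.fst) :=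
      ⟨fun _ _ h => List.Disjoint.symm h⟩
    exact hnd.2.forall (List.mem_finRange i) (List.mem_finRange j) hij he he'

theorem IsWalk.exists_mem_cutEdges {ends : E → Sym2 V} {Z : Set V} {a b : V} {l : List E}
    (h : IsWalk ends a b l) (ha : a ∈ Z) (hb : b ∉ Z) : ∃ e ∈ l, e ∈ cutEdges ends Z := by
  induction h with
  | nil => exact absurd ha hb
  | @cons u v w e l he _ ih =>
    by_cases hv : v ∈ Z
    · obtain ⟨e', h1, h2⟩ := ih hv hb
      exact ⟨e', List.mem_cons_of_mem _ h1, h2⟩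
    · exact ⟨e, List.mem_cons_self, u, ha, v, hv, he⟩

theorem le_ncard_cutEdges [Finite E] {ends : E → Sym2 V} {F : Set E} {n : ℕ} {a b : V} {Z : Set V}
    (h : EdgeDisjointPathsIn ends F n a b) (ha : a ∈ Z) (hb : b ∉ Z) :
    n ≤ (cutEdges ends Z).ncard := by
  obtain ⟨p, hp, hdis⟩ := h
  choose f hf hf' using fun i => (hp i).1.exists_mem_cutEdges ha hb
  have hinj : Function.Injective f := by
    intro i j hij
    by_contra hne
    exact hdis i j hne (f i) (hf i) (hij ▸ hf j)
  calc n = (Set.range f).ncard := by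
        rw [← Set.image_univ, Set.ncard_image_of_injective _ hinj, Set.ncard_univ, Nat.card_fin]
    _ ≤ _ := Set.ncard_le_ncard (by rintro _ ⟨i, rfl⟩; exact hf' i) (Set.toFinite _)

theorem cutEdges_compl (ends : E → Sym2 V) (Z : Set V) : cutEdges ends Zᶜ = cutEdges ends Z := by
  have key : ∀ Z : Set V, cutEdges ends Zᶜ ⊆ cutEdges ends Z := by
    rintro Z e ⟨a, ha, b, hb, hab⟩
    exact ⟨b, by simpa using hb, a, ha, hab.trans Sym2.eq_swap⟩
  exact (key Z).antisymm (by simpa using key Zᶜ)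

theorem Reaches.mono {ends : E → Sym2 V} {F F' : Set E} (hF : F ⊆ F') {a b : V}
    (h : Reaches ends F a b) : Reaches ends F' a b :=
  Relation.ReflTransGen.mono (fun _ _ ⟨e, he, hab⟩ => ⟨e, hF he, hab⟩) _ _ h

theorem Reaches.symm {ends : E → Sym2 V} {F : Set E} {a b : V}
    (h : Reaches ends F a b) : Reaches ends F b a := by
  have hs : Std.Symm (Step ends F) := ⟨fun _ _ ⟨e, he, hab⟩ => ⟨e, he, hab.trans Sym2.eq_swap⟩⟩
  exact Relation.ReflTransGen.stdSymm.symm _ _ h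

/-- The edges that some walk of the family leaves `u` by. -/
def outEdges {n : ℕ} (L : Fin n → List (E × V × V)) (u : V) : Set E :=
  {e | ∃ j, ∃ d ∈ L j, d.1 = e ∧ d.2.1 = u}

open Classical in
theorem IsDartWalk.countP_le {ends : E → Sym2 V} {T : Set V} {a : V} {l : List (E × V × V)}
    (h : IsDartWalk ends T a l) (u : V) :
    l.countP (fun d => d.2.1 = u) ≤ l.countP (fun d => d.2.2 = u) + if a = u then 1 else 0 := by
  induction h with
  | nil => simp
  | cons _ _ _ ih =>
    simp only [List.countP_cons, decide_eq_true_eq]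
    omega

open Classical in
theorem countP_flatMap_le {ends : E → Sym2 V} {T : Set V} {s : V} {n : ℕ}
    {L : Fin n → List (E × V × V)} (hL : ∀ j, IsDartWalk ends T s (L j)) (u : V)
    (js : List (Fin n)) :
    (js.flatMap L).countP (fun d => d.2.1 = u) ≤
      (js.flatMap L).countP (fun d => d.2.2 = u) + if s = u then js.length else 0 := by
  induction js with
  | nil => simp
  | cons j js ih =>
    have := (hL j).countP_le u
    simp only [List.flatMap_cons, List.countP_append, List.length_cons]
    split_ifs at this ih ⊢ <;> omega

open Classical in
theorem ncard_outEdges_le {n : ℕ} (L : Fin n → List (E × V × V)) (u : V) :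
    (outEdges L u).ncard ≤ ((List.finRange n).flatMap L).countP (fun d => d.2.1 = u) := by
  have : outEdges L u = ↑((((List.finRange n).flatMap L).filter
      (fun d => d.2.1 = u)).map Prod.fst).toFinset := by
    ext e
    simp [outEdges]
    grind
  rw [this, Set.ncard_coe_finset, List.countP_eq_length_filter]
  exact (List.toFinset_card_le _).trans (by simp)

theorem ncard_outEdges_source_le {ends : E → Sym2 V} {T : Set V} {s : V} {n : ℕ}
    {L : Fin n → List (E × V × V)} (hL : ∀ j, IsDartWalk ends T s (L j))
    (hs : ∀ j, ∀ d ∈ L j, d.2.2 ≠ s) : (outEdges L s).ncard ≤ n := by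
  classical
  refine (ncard_outEdges_le L s).trans ((countP_flatMap_le hL s _).trans ?_)
  have : ((List.finRange n).flatMap L).countP (fun d => d.2.2 = s) = 0 := by
    rw [List.countP_eq_zero]
    intro d hd
    obtain ⟨j, -, hj⟩ := List.mem_flatMap.1 hd
    simpa using hs j d hj
  simp [this]

theorem two_mul_ncard_outEdges_le [Finite E] {ends : E → Sym2 V} {T : Set V} {s u : V} {n : ℕ}
    {L : Fin n → List (E × V × V)} (hL : ∀ j, IsDartWalk ends T s (L j)) (hu : s ≠ u)
    (hnd : (((List.finRange n).flatMap L).map Prod.fst).Nodup)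
    (hd : ∀ j, ∀ d ∈ L j, ends d.1 = s(d.2.1, d.2.2) ∧ d.2.1 ≠ d.2.2) :
    2 * (outEdges L u).ncard ≤ deg ends u := by
  classical
  set A := (List.finRange n).flatMap L with hA
  have h1 := ncard_outEdges_le L u
  have h2 := countP_flatMap_le hL u (List.finRange n)
  rw [if_neg hu, ← hA] at h2
  rw [← hA] at h1
  have hdA : ∀ d ∈ A, ends d.1 = s(d.2.1, d.2.2) ∧ d.2.1 ≠ d.2.2 := by
    intro d h
    obtain ⟨j, -, hj⟩ := List.mem_flatMap.1 h
    exact hd j d hj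
  have hadd : ∀ l : List (E × V × V), (∀ d ∈ l, d.2.1 ≠ d.2.2) →
      l.countP (fun d => d.2.1 = u) + l.countP (fun d => d.2.2 = u) =
        l.countP (fun d => d.2.1 = u ∨ d.2.2 = u) := by
    intro l hl
    induction l with
    | nil => simp
    | cons d l ih =>
      have ih := ih fun d' h => hl d' (List.mem_cons_of_mem _ h)
      have hne := hl d List.mem_cons_self
      simp only [List.countP_cons, decide_eq_true_eq]
      by_cases h3 : d.2.1 = u <;> by_cases h4 : d.2.2 = u
      · exact absurd (h3.trans h4.symm) hne
      all_goals simp [h3, h4] at ih ⊢; omega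
  have h3 := hadd A fun d h => (hdA d h).2
  have h4 : A.countP (fun d => d.2.1 = u ∨ d.2.2 = u) ≤ deg ends u := by
    have hsub := (List.filter_sublist (l := A) (p := fun d => d.2.1 = u ∨ d.2.2 = u)).map Prod.fst
    rw [List.countP_eq_length_filter, ← List.length_map (f := Prod.fst),
      ← List.toFinset_card_of_nodup (hnd.sublist hsub), ← Set.ncard_coe_finset]
    refine Set.ncard_le_ncard ?_ (Set.toFinite _)
    intro e he
    obtain ⟨d, hdm, rfl⟩ := List.mem_map.1 (List.mem_toFinset.1 (Finset.mem_coe.1 he))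
    obtain ⟨hdA', hor⟩ := List.mem_filter.1 hdm
    rw [decide_eq_true_eq] at hor
    change u ∈ ends d.1
    rw [(hdA d hdA').1, Sym2.mem_iff]
    exact hor.imp Eq.symm Eq.symm
  omega

/-- Vertices reachable from `s` by following `m` darts of `D`. -/
inductive ReachesIn (D : Set (E × V × V)) (s : V) : ℕ → V → Prop
  | zero : ReachesIn D s 0 s
  | succ {m : ℕ} {d : E × V × V} : ReachesIn D s m d.2.1 → d ∈ D → ReachesIn D s (m + 1) d.2.2

theorem IsDartWalk.reachesIn {ends : E → Sym2 V} {T : Set V} {D : Set (E × V × V)} {s a : V}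
    {l : List (E × V × V)} (h : IsDartWalk ends T a l) {m : ℕ} (hm : ReachesIn D s m a)
    (hl : ∀ d ∈ l, d ∈ D) : ∀ d ∈ l, ∃ m, ReachesIn D s m d.2.1 := by
  induction h generalizing m with
  | nil => simp
  | @cons a b e l _ _ _ ih =>
    intro d hd
    rcases List.mem_cons.1 hd with rfl | hd
    · exact ⟨m, hm⟩
    · exact ih (ReachesIn.succ (d := (e, a, b)) hm (hl _ List.mem_cons_self))
        (fun c hc => hl c (List.mem_cons_of_mem _ hc)) d hd

/-- A breadth-first tree: inside `X`, one entering dart per reachable vertex suffices. -/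
theorem exists_parent_darts [Nonempty E] (ends : E → Sym2 V) (D : Set (E × V × V)) (s : V) (X : Set V)
    (hD : ∀ d ∈ D, ends d.1 = s(d.2.1, d.2.2) ∧ d.2.1 ∈ X) :
    ∃ par : V → E × V × V,
      (∀ w m, ReachesIn D s m w → w ≠ s → par w ∈ D ∧ (par w).2.2 = w) ∧
      ∀ m w, ReachesIn D s m w → w ∈ X →
        Reaches ends {e | ∃ w m, ReachesIn D s m w ∧ w ≠ s ∧ w ∈ X ∧ (par w).1 = e} s w := by
  classical
  have hex : ∀ w, (∃ m, ReachesIn D s m w) → w ≠ s → ∃ d : E × V × V,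
      d ∈ D ∧ d.2.2 = w ∧ ∀ m, ReachesIn D s m w → ∃ m' < m, ReachesIn D s m' d.2.1 := by
    intro w h hw
    have hspec := Nat.find_spec h
    generalize hN : Nat.find h = N at hspec
    cases hspec with
    | zero => exact absurd rfl hw
    | @succ m d hd hdD =>
      refine ⟨d, hdD, rfl, fun m' hm' => ⟨m, ?_, hd⟩⟩
      have := Nat.find_min' h hm'
      omega
  have : Nonempty (E × V × V) := ⟨Classical.arbitrary E, s, s⟩
  choose! par hpar using hex
  refine ⟨par, fun w m h hw => ⟨(hpar w ⟨m, h⟩ hw).1, (hpar w ⟨m, h⟩ hw).2.1⟩, ?_⟩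
  intro m
  induction m using Nat.strong_induction_on with
  | _ m ih =>
    intro w hw hwX
    by_cases hws : w = s
    · subst hws
      exact Relation.ReflTransGen.refl
    obtain ⟨h1, h2, h3⟩ := hpar w ⟨m, hw⟩ hws
    obtain ⟨m', hm', hr⟩ := h3 m hw
    refine (ih m' hm' _ hr (hD _ h1).2).tail ⟨(par w).1, ⟨w, m, hw, hws, hwX, rfl⟩, ?_⟩
    rw [(hD _ h1).1, h2]

/-- If `X` has a smallest edge cut among its subsets containing `r`, then the boundary edges of a
family of edge-disjoint subgraphs can be linked to `r` inside `X`, edge-disjointly and using few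
edges at each vertex. -/
theorem exists_absorbing_subgraphs [Finite V] [Finite E] (ends : E → Sym2 V) (X : Set V) (r : V)
    (hr : r ∈ X) {k : ℕ} (H : Fin k → Set E) (hH : PairwiseEdgeDisjoint H)
    (hcut : ∀ Z : Set V, r ∈ Z → Z ⊆ X → (cutEdges ends X).ncard ≤ (cutEdges ends Z).ncard) :
    ∃ F : Fin k → Set E, (∀ i, ∀ e ∈ F i, ∀ y ∈ ends e, y ∈ X) ∧ PairwiseEdgeDisjoint F ∧
      (∀ i, ∀ e ∈ F i, ∀ y ∈ ends e, Reaches ends (F i) r y) ∧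
      (∀ i, ∀ e ∈ H i, e ∈ cutEdges ends X → ∀ y ∈ ends e, y ∈ X → Reaches ends (F i) r y) ∧
      (∀ u ∈ X, u ≠ r → 2 * (incEdges ends u ∩ ⋃ i, F i ∪ (H i ∩ cutEdges ends X)).ncard ≤
        deg ends u + 2 * k) ∧
      (incEdges ends r ∩ ⋃ i, F i ∪ (H i ∩ cutEdges ends X)).ncard ≤
        (cutEdges ends X).ncard := by
  classical
  rcases isEmpty_or_nonempty E with hE | hE
  · refine ⟨fun _ => ∅, by simp, by simp [PairwiseEdgeDisjoint], by simp,
      fun _ e => isEmptyElim e, ?_, ?_⟩ <;> simp [Set.eq_empty_of_isEmpty]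
  set n := (cutEdges ends X).ncard with hn
  obtain ⟨L, hL, hnd, hLd⟩ := exists_dartWalks ends r Xᶜ (by simpa using hr) n
    (fun Z hrZ hZ => hcut Z hrZ (Set.disjoint_compl_right_iff_subset.1 hZ))
  have hLd' : ∀ j, ∀ d ∈ L j, d.2.1 ∈ X := fun j d hd => by simpa using (hLd j d hd).2.2.1
  have hLu : ∀ j j', ∀ d ∈ L j, ∀ d' ∈ L j', d.1 = d'.1 → j = j' ∧ d = d' := by
    intro j j' d hd d' hd' hdd
    have hd1 : d ∈ (List.finRange n).flatMap L :=
      List.mem_flatMap.2 ⟨j, List.mem_finRange j, hd⟩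
    have hd2 : d' ∈ (List.finRange n).flatMap L :=
      List.mem_flatMap.2 ⟨j', List.mem_finRange j', hd'⟩
    have heq : d = d' := List.inj_on_of_nodup_map hnd hd1 hd2 hdd
    refine ⟨?_, heq⟩
    by_contra hne
    have hnd' := (List.nodup_flatMap.1 hnd.of_map).2
    have hsymm : Std.Symm (Function.onFun List.Disjoint L) :=
      ⟨fun _ _ h => List.Disjoint.symm h⟩
    exact hnd'.forall (List.mem_finRange j) (List.mem_finRange j') hne hd (heq ▸ hd')
  have hlast : ∀ j, ∃ d ∈ L j, d.2.2 ∉ X := by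
    intro j
    have key : ∀ a l, IsDartWalk ends Xᶜ a l → a ∈ X → ∃ d ∈ l, d.2.2 ∉ X := by
      intro a l h
      induction h with
      | nil ht => exact fun ha => absurd ha ht
      | @cons a b e l _ _ _ ih =>
        intro _
        by_cases hb : b ∈ X
        · obtain ⟨d, hd, hdX⟩ := ih hb
          exact ⟨d, List.mem_cons_of_mem _ hd, hdX⟩
        · exact ⟨_, List.mem_cons_self, hb⟩
    exact key r (L j) (hL j) hr
  choose g hgL hgX using hlast
  have hgcut : ∀ j, (g j).1 ∈ cutEdges ends X := fun j =>
    ⟨_, hLd' j _ (hgL j), _, hgX j, (hLd j _ (hgL j)).1⟩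
  have hginj : Function.Injective fun j => (g j).1 := fun j j' h =>
    (hLu j j' _ (hgL j) _ (hgL j') h).1
  have hgsurj : ∀ e ∈ cutEdges ends X, ∃ j, (g j).1 = e := by
    have : Set.range (fun j => (g j).1) = cutEdges ends X := by
      refine Set.eq_of_subset_of_ncard_le (by rintro _ ⟨j, rfl⟩; exact hgcut j) ?_ (Set.toFinite _)
      rw [← Set.image_univ, Set.ncard_image_of_injective _ hginj, Set.ncard_univ, Nat.card_fin]
    intro e he
    rw [← this] at he
    exact he
  let D : Fin k → Set (E × V × V) := fun i => {d | ∃ j, d ∈ L j ∧ (g j).1 ∈ H i}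
  have hDu : ∀ i i' d d', d ∈ D i → d' ∈ D i' → d.1 = d'.1 → i = i' := by
    rintro i i' d d' ⟨j, hj, hji⟩ ⟨j', hj', hji'⟩ hdd
    obtain ⟨rfl, -⟩ := hLu j j' d hj d' hj' hdd
    by_contra hne
    exact Set.disjoint_left.1 (hH i i' hne) hji hji'
  have hDX : ∀ i, ∀ d ∈ D i, ends d.1 = s(d.2.1, d.2.2) ∧ d.2.1 ∈ X := by
    rintro i d ⟨j, hj, -⟩
    exact ⟨(hLd j d hj).1, hLd' j d hj⟩
  have hDr : ∀ i, ∀ d ∈ D i, ∃ m, ReachesIn (D i) r m d.2.1 := by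
    rintro i d ⟨j, hj, hji⟩
    exact (hL j).reachesIn (D := D i) ReachesIn.zero (fun d2 hd2 => ⟨j, hd2, hji⟩) d hj
  choose par hpar hreach using fun i => exists_parent_darts ends (D i) r X (hDX i)
  let F : Fin k → Set E := fun i =>
    {e | ∃ w m, ReachesIn (D i) r m w ∧ w ≠ r ∧ w ∈ X ∧ (par i w).1 = e}
  have hFends : ∀ i w m, ReachesIn (D i) r m w → w ≠ r →
      ends (par i w).1 = s((par i w).2.1, w) := by
    intro i w m hw hwr
    obtain ⟨h1, h2⟩ := hpar i w m hw hwr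
    rw [(hDX i _ h1).1, h2]
  have hout : ∀ i, ∀ d ∈ D i, d.1 ∈ outEdges L d.2.1 := by
    rintro i d ⟨j, hj, -⟩
    exact ⟨j, d, hj, rfl, rfl⟩
  have hdeg : ∀ u ∈ X, ∀ i, ∀ e ∈ F i ∪ (H i ∩ cutEdges ends X), u ∈ ends e →
      e ∈ outEdges L u ∨ (u ≠ r ∧ e = (par i u).1) := by
    rintro u hu i e (⟨w, m, hw, hwr, hwX, rfl⟩ | ⟨heH, hec⟩) hue
    · rw [hFends i w m hw hwr, Sym2.mem_iff] at hue
      rcases hue with rfl | rfl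
      · exact Or.inl (hout i _ (hpar i w m hw hwr).1)
      · exact Or.inr ⟨hwr, rfl⟩
    · obtain ⟨j, rfl⟩ := hgsurj e hec
      rw [(hLd j _ (hgL j)).1, Sym2.mem_iff] at hue
      rcases hue with rfl | rfl
      · exact Or.inl ⟨j, _, hgL j, rfl, rfl⟩
      · exact absurd hu (hgX j)
  refine ⟨F, ?_, ?_, ?_, ?_, ?_, ?_⟩
  · rintro i _ ⟨w, m, hw, hwr, hwX, rfl⟩ y hy
    rw [hFends i w m hw hwr, Sym2.mem_iff] at hy
    rcases hy with rfl | rfl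
    · exact (hDX i _ (hpar i w m hw hwr).1).2
    · exact hwX
  · intro i i' hne
    rw [Set.disjoint_left]
    rintro _ ⟨w, m, hw, hwr, hwX, rfl⟩ ⟨w', m', hw', hwr', hwX', heq⟩
    exact hne (hDu i i' _ _ (hpar i w m hw hwr).1 (hpar i' w' m' hw' hwr').1 heq.symm)
  · rintro i _ ⟨w, m, hw, hwr, hwX, rfl⟩ y hy
    rw [hFends i w m hw hwr, Sym2.mem_iff] at hy
    rcases hy with rfl | rfl
    · have hd := (hpar i w m hw hwr).1
      obtain ⟨m', hm'⟩ := hDr i _ hd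
      exact hreach i m' _ hm' (hDX i _ hd).2
    · exact hreach i m _ hw hwX
  · intro i e heH hec y hy hyX
    obtain ⟨j, rfl⟩ := hgsurj e hec
    have hd : g j ∈ D i := ⟨j, hgL j, heH⟩
    rw [(hDX i _ hd).1, Sym2.mem_iff] at hy
    rcases hy with rfl | rfl
    · obtain ⟨m', hm'⟩ := hDr i _ hd
      exact hreach i m' _ hm' hyX
    · exact absurd hyX (hgX j)
  · intro u hu hur
    have h1 : (incEdges ends u ∩ ⋃ i, F i ∪ (H i ∩ cutEdges ends X)) ⊆
        outEdges L u ∪ Set.range fun i => (par i u).1 := by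
      rintro e ⟨hue, he⟩
      obtain ⟨i, hi⟩ := Set.mem_iUnion.1 he
      rcases hdeg u hu i e hi hue with h | h
      · exact Or.inl h
      · exact Or.inr ⟨i, h.2.symm⟩
    have h2 : (Set.range fun i => (par i u).1).ncard ≤ k := by
      rw [← Set.image_univ]
      refine (Set.ncard_image_le (Set.toFinite _)).trans ?_
      rw [Set.ncard_univ, Nat.card_fin]
    have h3 := Set.ncard_le_ncard h1 (Set.toFinite _)
    have h4 := Set.ncard_union_le (outEdges L u) (Set.range fun i => (par i u).1)
    have h5 := two_mul_ncard_outEdges_le hL hur.symm hnd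
      (fun j d hd => ⟨(hLd j d hd).1, (hLd j d hd).2.1⟩)
    omega
  · refine (Set.ncard_le_ncard ?_ (Set.toFinite _)).trans
      (ncard_outEdges_source_le hL fun j d hd => (hLd j d hd).2.2.2)
    rintro e ⟨hue, he⟩
    obtain ⟨i, hi⟩ := Set.mem_iUnion.1 he
    rcases hdeg r hr i e hi hue with h | h
    · exact h
    · exact absurd rfl h.1

theorem balanceVertex_of_unused [Finite E] {ends : E → Sym2 V} {u : V} {k : ℕ} (hk : 0 < k)
    {H : Fin k → Set E} (hH : PairwiseEdgeDisjoint H)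
    (hu : 2 * k ≤ (incEdges ends u \ ⋃ i, H i).ncard) : BalanceVertex ends H u := by
  classical
  set U := incEdges ends u \ ⋃ i, H i with hU
  have hcard : Nat.card (Fin k × Fin 2) ≤ Nat.card U := by
    rw [Nat.card_coe_set_eq]
    simp
    omega
  obtain ⟨f⟩ : Nonempty (Fin k × Fin 2 ↪ U) := by
    have := Fintype.ofFinite U
    refine Function.Embedding.nonempty_of_card_le ?_
    simpa [Nat.card_eq_fintype_card] using hcard
  let c : U → Fin k := fun x => if h : ∃ y, f y = x then h.choose.1 else ⟨0, hk⟩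
  have hc : ∀ y, c (f y) = y.1 := by
    intro y
    have h : ∃ y', f y' = f y := ⟨y, rfl⟩
    simp only [c, dif_pos h]
    rw [f.injective h.choose_spec]
  have hsub : IsSubpartitionAt ends u fun i => incEdges ends u ∩ H i :=
    ⟨fun i => Set.inter_subset_left, fun i j hij =>
      (hH i j hij).mono Set.inter_subset_right Set.inter_subset_right⟩
  refine ⟨hsub, fun i => (incEdges ends u ∩ H i) ∪ {e | ∃ h : e ∈ U, c ⟨e, h⟩ = i},
    ⟨⟨?_, ?_⟩, ?_, ?_⟩, fun i => Set.subset_union_left⟩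
  · rintro i e (h | ⟨h, -⟩)
    · exact h.1
    · exact h.1
  · intro i j hij
    rw [Set.disjoint_left]
    rintro e (h | ⟨h, hi⟩) (h' | ⟨h', hj⟩)
    · exact Set.disjoint_left.1 (hH i j hij) h.2 h'.2
    · exact h'.2 (Set.mem_iUnion.2 ⟨i, h.2⟩)
    · exact h.2 (Set.mem_iUnion.2 ⟨j, h'.2⟩)
    · exact hij (hi.symm.trans hj)
  · ext e
    refine ⟨fun h => ?_, fun h => ?_⟩
    · obtain ⟨i, h | ⟨h, -⟩⟩ := Set.mem_iUnion.1 h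
      · exact h.1
      · exact h.1
    · by_cases he : e ∈ ⋃ i, H i
      · obtain ⟨i, hi⟩ := Set.mem_iUnion.1 he
        exact Set.mem_iUnion.2 ⟨i, Or.inl ⟨h, hi⟩⟩
      · exact Set.mem_iUnion.2 ⟨c ⟨e, h, he⟩, Or.inr ⟨⟨h, he⟩, rfl⟩⟩
  · intro i
    have hinj : Function.Injective fun b : Fin 2 => (f (i, b)).1 := fun b b' h => by
      simpa using f.injective (Subtype.ext h)
    calc 2 = (Set.range fun b : Fin 2 => (f (i, b)).1).ncard := by
          rw [← Set.image_univ, Set.ncard_image_of_injective _ hinj, Set.ncard_univ, Nat.card_fin]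
      _ ≤ _ := Set.ncard_le_ncard (by
          rintro _ ⟨b, rfl⟩
          exact Or.inr ⟨(f (i, b)).2, hc (i, b)⟩) (Set.toFinite _)

theorem isBalancedSubpartitionAt_congr {V' : Type} {ends : E → Sym2 V} {ends' : E → Sym2 V'}
    {u : V} {u' : V'} (h : incEdges ends u = incEdges ends' u') {k : ℕ} (P : Fin k → Set E) :
    IsBalancedSubpartitionAt ends u P ↔ IsBalancedSubpartitionAt ends' u' P := by
  simp only [IsBalancedSubpartitionAt, IsBalancedPartitionAt, IsSubpartitionAt, h]

/-- The vertices left after contracting `X` onto its vertex `r`. -/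
abbrev Contracted (X : Set V) (r : V) : Type := {w : V // w ∉ X ∨ w = r}

open Classical in
/-- The quotient map contracting `X` onto its vertex `r`. -/
noncomputable def collapse (X : Set V) (r : V) (w : V) : Contracted X r :=
  if h : w ∈ X then ⟨r, Or.inr rfl⟩ else ⟨w, Or.inl h⟩

/-- The multigraph with `X` contracted; the edges inside `X` become loops. -/
noncomputable def contractEnds (ends : E → Sym2 V) (X : Set V) (r : V) :
    E → Sym2 (Contracted X r) := fun e => (ends e).map (collapse X r)

section Contract

variable {ends : E → Sym2 V} {X : Set V} {r : V}

theorem collapse_of_mem {w : V} (h : w ∈ X) : collapse X r w = ⟨r, Or.inr rfl⟩ := dif_pos h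

theorem collapse_of_notMem {w : V} (h : w ∉ X) : collapse X r w = ⟨w, Or.inl h⟩ := dif_neg h

theorem collapse_val (hr : r ∈ X) (a : Contracted X r) : collapse X r a.1 = a := by
  obtain ⟨w, hw⟩ := a
  by_cases h : w ∈ X
  · have : w = r := hw.resolve_left (fun h' => h' h)
    subst this
    exact collapse_of_mem h
  · exact collapse_of_notMem h

theorem collapse_eq_iff (hr : r ∈ X) {u : Contracted X r} (hu : u.1 ∉ X) {w : V} :
    collapse X r w = u ↔ w = u.1 := by
  refine ⟨fun h => ?_, fun h => h ▸ collapse_val hr u⟩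
  by_cases hw : w ∈ X
  · rw [collapse_of_mem hw] at h
    exact absurd hr (by rw [← h] at hu; exact hu)
  · rw [collapse_of_notMem hw] at h
    rw [← h]

theorem incEdges_contract (hr : r ∈ X) {u : Contracted X r} (hu : u.1 ∉ X) :
    incEdges (contractEnds ends X r) u = incEdges ends u.1 := by
  ext e
  simp only [incEdges, contractEnds, Set.mem_ofPred_eq, Sym2.mem_map, collapse_eq_iff hr hu,
    exists_eq_right]

theorem IsWalk.contract {a b : V} {l : List E} (h : IsWalk ends a b l) :
    IsWalk (contractEnds ends X r) (collapse X r a) (collapse X r b) l := by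
  induction h with
  | nil => exact IsWalk.nil _
  | cons he _ ih => exact IsWalk.cons (by simp [contractEnds, he]) ih

theorem EdgeConnectedIn.contract {S : Set V} {n : ℕ} (hr : r ∈ X)
    (h : EdgeConnectedIn ends Set.univ S n) :
    EdgeConnectedIn (contractEnds ends X r) Set.univ (Subtype.val ⁻¹' S) n := by
  intro a ha b hb hab
  obtain ⟨p, hp, hdis⟩ := h a.1 ha b.1 hb fun h => hab (Subtype.ext h)
  refine ⟨p, fun i => ⟨?_, (hp i).2⟩, hdis⟩
  simpa only [collapse_val hr] using (hp i).1.contract (X := X) (r := r)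

theorem extMeasure_contract_lt [Finite V] [Finite E] {w : V} (hw : w ∈ X) (hwr : w ≠ r) :
    extMeasure (contractEnds ends X r) < extMeasure ends := by
  refine Nat.add_lt_add_of_lt_of_le (Finite.card_subtype_lt (x := w) (by simp [hw, hwr])) ?_
  refine Set.ncard_le_ncard (fun e he hdiag => he ?_) (Set.toFinite _)
  exact Sym2.IsDiag.map hdiag

/-- Connections in the contracted graph lift when boundary edges are linked to `r` by `F`. -/
theorem Reaches.of_contract {H F : Set E}
    (hF : ∀ e ∈ H, e ∈ cutEdges ends X → ∀ y ∈ ends e, y ∈ X → Reaches ends F r y)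
    {a b : Contracted X r} (h : Reaches (contractEnds ends X r) H a b) :
    Reaches ends ({e ∈ H | ∃ y ∈ ends e, y ∉ X} ∪ F) a.1 b.1 := by
  have hout : ∀ e ∈ H, ∀ x y, ends e = s(x, y) → y ∉ X →
      Reaches ends ({e ∈ H | ∃ y ∈ ends e, y ∉ X} ∪ F) (collapse X r x).1 (collapse X r y).1 := by
    intro e he x y hxy hy
    have hstep : Reaches ends ({e ∈ H | ∃ y ∈ ends e, y ∉ X} ∪ F) x y :=
      Relation.ReflTransGen.single ⟨e, Or.inl ⟨he, y, by simp [hxy], hy⟩, hxy⟩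
    rw [collapse_of_notMem hy]
    by_cases hx : x ∈ X
    · rw [collapse_of_mem hx]
      exact ((hF e he ⟨x, hx, y, hy, hxy⟩ x (by simp [hxy]) hx).mono
        Set.subset_union_right).trans hstep
    · rw [collapse_of_notMem hx]
      exact hstep
  have hedge : ∀ e ∈ H, ∀ x y, ends e = s(x, y) →
      Reaches ends ({e ∈ H | ∃ y ∈ ends e, y ∉ X} ∪ F) (collapse X r x).1 (collapse X r y).1 := by
    intro e he x y hxy
    by_cases hy : y ∈ X
    · by_cases hx : x ∈ X
      · rw [collapse_of_mem hx, collapse_of_mem hy]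
        exact Relation.ReflTransGen.refl
      · exact (hout e he y x (hxy.trans Sym2.eq_swap) hx).symm
    · exact hout e he x y hxy hy
  induction h with
  | refl => exact Relation.ReflTransGen.refl
  | tail _ hstep ih =>
    refine ih.trans ?_
    obtain ⟨e, he, hab⟩ := hstep
    generalize hz : ends e = z at *
    induction z with
    | _ x y =>
      simp only [contractEnds, hz, Sym2.map_mk] at hab
      rcases Sym2.eq_iff.1 hab with ⟨rfl, rfl⟩ | ⟨rfl, rfl⟩
      · exact hedge e he x y hz
      · exact (hedge e he x y hz).symm

theorem Reaches.contract {A F H : Set E} (hA : A ⊆ H) (hF : ∀ e ∈ F, ∀ y ∈ ends e, y ∈ X)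
    {a b : V} (h : Reaches ends (A ∪ F) a b) :
    Reaches (contractEnds ends X r) H (collapse X r a) (collapse X r b) := by
  induction h with
  | refl => exact Relation.ReflTransGen.refl
  | @tail b c _ hstep ih =>
    obtain ⟨e, he | he, hab⟩ := hstep
    · exact ih.tail ⟨e, hA he, by simp [contractEnds, hab]⟩
    · have hb := hF e he b (by simp [hab])
      have hc := hF e he c (by simp [hab])
      rwa [collapse_of_mem hc, ← collapse_of_mem hb]

theorem ExtCex.contract [Finite V] [Finite E] {Q k : ℕ} {S R : Set V} {v : V} {P : Fin k → Set E}
    (h : ExtCex Q k ends S R v P) (hr : r ∈ X) (hSX : Disjoint S X) (hvX : v ∉ X)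
    (hno : NoGoodPacking (contractEnds ends X r) (Subtype.val ⁻¹' S) (Subtype.val ⁻¹' (R \ X))
      ⟨v, Or.inl hvX⟩ P) :
    ExtCex Q k (contractEnds ends X r) (Subtype.val ⁻¹' S) (Subtype.val ⁻¹' (R \ X))
      ⟨v, Or.inl hvX⟩ P := by
  obtain ⟨hQ, hk, hSR, hS, hconn, hR, hvS, hloop, hdeg, hP, hP2, -⟩ := h
  have hinc := incEdges_contract (ends := ends) hr (u := ⟨v, Or.inl hvX⟩) hvX
  refine ⟨hQ, hk, ?_, ?_, hconn.contract hr, ?_, hvS, ?_, ?_, ?_, hP2, hno⟩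
  · exact (hSR.mono_right Set.sdiff_subset).preimage _
  · rwa [Set.ncard_preimage_of_injective_subset_range Subtype.val_injective]
    intro w hw
    exact ⟨⟨w, Or.inl (Set.disjoint_left.1 hSX hw)⟩, rfl⟩
  · intro u hu
    rw [deg, incEdges_contract hr hu.2]
    exact hR _ hu.1
  · intro e he hdiag
    have hve : v ∈ ends e := by
      have : e ∈ incEdges ends v := hinc ▸ he
      exact this
    obtain ⟨w, hw⟩ := Sym2.mem_iff_exists.1 hve
    have hwv : w = v := by
      rw [contractEnds, hw, Sym2.map_mk, Sym2.mk_isDiag_iff, collapse_of_notMem hvX] at hdiag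
      exact (collapse_eq_iff hr (u := ⟨v, Or.inl hvX⟩) hvX).1 hdiag.symm
    exact hloop e hve (by rw [hw, hwv]; exact Sym2.mk_isDiag_iff.2 rfl)
  · rw [deg, hinc]
    exact hdeg
  · exact (isBalancedSubpartitionAt_congr hinc P).2 hP

/-- A packing of the contracted graph lifts to the original graph. -/
theorem exists_packing_of_contract [Finite V] [Finite E] {Q k : ℕ} (hQ : 36 ≤ Q) (hk : 0 < k)
    {S R : Set V} {v : V} {P : Fin k → Set E} (hr : r ∈ X) (hSX : Disjoint S X) (hvX : v ∉ X)
    (hR : ∀ w ∈ R, (Q - 2) * k ≤ deg ends w) (hP : ∀ i, P i ⊆ incEdges ends v)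
    (hsmall : (cutEdges ends X).ncard < (Q - 4) * k)
    (hcut : ∀ Z : Set V, r ∈ Z → Z ⊆ X → (cutEdges ends X).ncard ≤ (cutEdges ends Z).ncard)
    (h : ¬ NoGoodPacking (contractEnds ends X r) (Subtype.val ⁻¹' S) (Subtype.val ⁻¹' (R \ X))
      ⟨v, Or.inl hvX⟩ P) :
    ¬ NoGoodPacking ends S R v P := by
  rw [NoGoodPacking, not_not] at h ⊢
  obtain ⟨H, hdis, hconn, hbal, hext⟩ := h
  obtain ⟨F, hFX, hFdis, hFr, hFH, hFdeg, hFdegr⟩ :=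
    exists_absorbing_subgraphs ends X r hr H hdis hcut
  let H' : Fin k → Set E := fun i => {e ∈ H i | ∃ y ∈ ends e, y ∉ X} ∪ F i
  have hdis' : PairwiseEdgeDisjoint H' := by
    intro i j hij
    rw [Set.disjoint_left]
    rintro e (⟨h1, y, hy, hyX⟩ | h1) (⟨h2, y', hy', hyX'⟩ | h2)
    · exact Set.disjoint_left.1 (hdis i j hij) h1 h2
    · exact hyX (hFX j e h2 y hy)
    · exact hyX' (hFX i e h1 y' hy')
    · exact Set.disjoint_left.1 (hFdis i j hij) h1 h2
  have hcutmem : ∀ e x y, x ∈ ends e → x ∈ X → y ∈ ends e → y ∉ X → e ∈ cutEdges ends X := by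
    intro e x y hx hxX hy hyX
    refine ⟨x, hxX, y, hyX, ?_⟩
    have hxy : x ≠ y := fun hxy => hyX (hxy ▸ hxX)
    exact (Sym2.mem_and_mem_iff hxy).1 ⟨hx, hy⟩
  refine ⟨H', hdis', ?_, ?_, ?_⟩
  · intro i a ha b hb
    exact Reaches.of_contract (hFH i)
      (hconn i ⟨a, Or.inl (Set.disjoint_left.1 hSX ha)⟩ ha
        ⟨b, Or.inl (Set.disjoint_left.1 hSX hb)⟩ hb)
  · intro u hu
    by_cases huX : u ∈ X
    · have huR : u ∈ R := hu.resolve_left fun h => Set.disjoint_left.1 hSX h huX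
      refine balanceVertex_of_unused hk hdis' ?_
      have h1 : (incEdges ends u ∩ ⋃ i, H' i) ⊆
          incEdges ends u ∩ ⋃ i, F i ∪ (H i ∩ cutEdges ends X) := by
        rintro e ⟨hue, he⟩
        obtain ⟨i, hi⟩ := Set.mem_iUnion.1 he
        refine ⟨hue, Set.mem_iUnion.2 ⟨i, ?_⟩⟩
        rcases hi with ⟨hi, y, hy, hyX⟩ | hi
        · exact Or.inr ⟨hi, hcutmem e u y hue huX hy hyX⟩
        · exact Or.inl hi
      have h2 := Set.ncard_le_ncard h1 (Set.toFinite _)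
      have h3 := Set.ncard_inter_add_ncard_sdiff_eq_ncard (incEdges ends u) (⋃ i, H' i)
        (Set.toFinite _)
      have h4 := hR u huR
      rw [deg] at h4
      by_cases hur : u = r
      · subst hur
        have h5 : (Q - 2) * k = (Q - 4) * k + 2 * k := by
          rw [← add_mul]
          congr 1
          omega
        omega
      · have h5 := hFdeg u huX hur
        have h6 : 34 * k ≤ (Q - 2) * k := Nat.mul_le_mul_right k (by omega)
        rw [deg] at h5
        omega
    · have hb := hbal ⟨u, Or.inl huX⟩ (hu.imp id fun h => ⟨h, huX⟩)
      have hinc := incEdges_contract (ends := ends) hr (u := ⟨u, Or.inl huX⟩) huX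
      have hEq : (fun i => incEdges ends u ∩ H' i) = fun i => incEdges ends u ∩ H i := by
        funext i
        ext e
        refine ⟨?_, fun h => ⟨h.1, Or.inl ⟨h.2, u, h.1, huX⟩⟩⟩
        rintro ⟨h1, h2 | h2⟩
        · exact ⟨h1, h2.1⟩
        · exact absurd (hFX i e h2 u h1) huX
      rw [BalanceVertex, hinc, isBalancedSubpartitionAt_congr hinc] at hb
      rwa [BalanceVertex, hEq]
  · intro i
    refine ⟨fun e he => Or.inl ⟨(hext i).1 he, v, hP i he, hvX⟩, ?_⟩
    rintro ⟨a, b, hav, hbv, hab, hnot⟩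
    apply hnot
    by_cases hne : a = b
    · subst hne
      exact Relation.ReflTransGen.refl
    have hsub : F i ⊆ {e ∈ H' i | v ∉ ends e} := fun e he =>
      ⟨Or.inr he, fun hv => hvX (hFX i e he v hv)⟩
    have hroot : ∀ x y, x ≠ y → Reaches ends (H' i) x y →
        Reaches ends {e ∈ H' i | v ∉ ends e} (collapse X r x).1 x := by
      intro x y hxy hreach
      by_cases hx : x ∈ X
      · rw [collapse_of_mem hx]
        rcases Relation.ReflTransGen.cases_head hreach with rfl | ⟨z, ⟨e, he, hez⟩, -⟩
        · exact absurd rfl hxy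
        have hxe : x ∈ ends e := by simp [hez]
        rcases he with ⟨he, w, hw, hwX⟩ | he
        · exact (hFH i e he (hcutmem e x w hxe hx hw hwX) x hxe hx).mono hsub
        · exact (hFr i e he x hxe).mono hsub
      · rw [collapse_of_notMem hx]
        exact Relation.ReflTransGen.refl
    have hcol : ∀ x, x ≠ v → collapse X r x ≠ ⟨v, Or.inl hvX⟩ := fun x hx h =>
      hx ((collapse_eq_iff hr (u := ⟨v, Or.inl hvX⟩) hvX).1 h)
    have hab1 : Reaches (contractEnds ends X r) (H i) (collapse X r a) (collapse X r b) :=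
      Reaches.contract (fun e he => he.1) (hFX i) hab
    have hab2 : Reaches (contractEnds ends X r)
        {e ∈ H i | ⟨v, Or.inl hvX⟩ ∉ contractEnds ends X r e} (collapse X r a)
        (collapse X r b) := by
      by_contra hcon
      exact (hext i).2 ⟨_, _, hcol a hav, hcol b hbv, hab1, hcon⟩
    have hab3 := Reaches.of_contract (fun e he => hFH i e he.1) hab2
    have hinc := incEdges_contract (ends := ends) hr (u := ⟨v, Or.inl hvX⟩) hvX
    have hab4 : Reaches ends {e ∈ H' i | v ∉ ends e} (collapse X r a).1 (collapse X r b).1 := by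
      refine hab3.mono (Set.union_subset ?_ hsub)
      rintro e ⟨⟨he, hve⟩, hy⟩
      refine ⟨Or.inl ⟨he, hy⟩, fun hv => hve ?_⟩
      have : e ∈ incEdges (contractEnds ends X r) ⟨v, Or.inl hvX⟩ := by
        rw [hinc]
        exact hv
      exact this
    exact ((hroot a b hne hab).symm.trans hab4).trans (hroot b a (Ne.symm hne) hab.symm)

end Contract

theorem MinExtCex.le_ncard_cutEdges [Finite V] [Finite E] {Q k : ℕ} {ends : E → Sym2 V}
    {S R : Set V} {v : V} {P : Fin k → Set E} (h : MinExtCex Q k ends S R v P)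
    (hloops : ∀ r ∈ R, {e : E | ends e = Sym2.diag r}.ncard < 2 * k)
    {X : Set V} (hSX : Disjoint S X) (hRX : (R ∩ X).Nonempty) :
    (Q - 4) * k ≤ (cutEdges ends X).ncard := by
  by_contra! hlt
  obtain ⟨Y, ⟨hSY, r, hrR, hrY⟩, hmin⟩ := Set.exists_min_image
    {Y : Set V | Disjoint S Y ∧ (R ∩ Y).Nonempty} (fun Y => (cutEdges ends Y).ncard)
    (Set.toFinite _) ⟨X, hSX, hRX⟩
  have hsmall : (cutEdges ends Y).ncard < (Q - 4) * k := (hmin X ⟨hSX, hRX⟩).trans_lt hlt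
  obtain ⟨hcex, hleast⟩ := h
  obtain ⟨hQ, hk, -, -, -, hR, hvS, -, -, hP, -, hno⟩ := id hcex
  have hother : ∃ w ∈ Y, w ≠ r := by
    by_contra! hall
    have hsub : incEdges ends r ⊆ {e : E | ends e = Sym2.diag r} ∪ cutEdges ends Y := by
      intro e he
      obtain ⟨w, hw⟩ := Sym2.mem_iff_exists.1 (show r ∈ ends e from he)
      by_cases hwY : w ∈ Y
      · left
        rw [hall w hwY] at hw
        exact hw
      · exact Or.inr ⟨r, hrY, w, hwY, hw⟩
    have h1 := Set.ncard_le_ncard hsub (Set.toFinite _)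
    have h2 := Set.ncard_union_le {e : E | ends e = Sym2.diag r} (cutEdges ends Y)
    have h3 := hloops r hrR
    have h4 := hR r hrR
    rw [deg] at h4
    have h5 : (Q - 2) * k = (Q - 4) * k + 2 * k := by
      rw [← add_mul]
      congr 1
      omega
    omega
  obtain ⟨w, hwY, hwr⟩ := hother
  have hvY : v ∉ Y := Set.disjoint_left.1 hSY hvS
  refine exists_packing_of_contract hQ hk hrY hSY hvY hR hP.1.1 hsmall ?_ ?_ hno
  · exact fun Z hrZ hZY => hmin Z ⟨hSY.mono_right hZY, r, hrR, hrZ⟩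
  · intro hno'
    have := hleast _ E inferInstance inferInstance _ _ _ _ P (hcex.contract hrY hSY hvY hno')
    exact (extMeasure_contract_lt hwY hwr).not_ge this

/-- In a minimal counterexample to the Extension Theorem in
which every vertex of `R` is incident to fewer than `2k` self-loops, the set
`S ∪ R` is `(Q−4)k`-edge-connected in `G`. -/
theorem min_cex_SR_connected {V E : Type} [Fintype V] [Fintype E]
    (Q k : ℕ) (ends : E → Sym2 V) (S R : Set V) (v : V) (P : Fin k → Set E)
    (h : MinExtCex Q k ends S R v P)
    (hloops : ∀ r ∈ R, {e : E | ends e = Sym2.diag r}.ncard < 2 * k) :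
    EdgeConnectedIn ends Set.univ (S ∪ R) ((Q - 4) * k) := by
  obtain ⟨-, -, -, -, hconn, -⟩ := id h.1
  intro a ha b hb hab
  refine edgeDisjointPathsIn_of_cut ends hab _ fun Z haZ hbZ => ?_
  by_cases hsplit : ∃ x ∈ S, ∃ y ∈ S, x ∈ Z ∧ y ∉ Z
  · obtain ⟨x, hx, y, hy, hxZ, hyZ⟩ := hsplit
    exact (Nat.mul_le_mul_right k (Nat.sub_le Q 4)).trans
      (le_ncard_cutEdges (hconn x hx y hy fun hxy => hyZ (hxy ▸ hxZ)) hxZ hyZ)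
  push Not at hsplit
  by_cases hSZ : ∃ x ∈ S, x ∈ Z
  · obtain ⟨x, hx, hxZ⟩ := hSZ
    have hsub : S ⊆ Z := fun y hy => hsplit x hx y hy hxZ
    rw [← cutEdges_compl]
    exact h.le_ncard_cutEdges hloops (Set.disjoint_compl_right_iff_subset.2 hsub)
      ⟨b, hb.resolve_left fun hbS => hbZ (hsub hbS), hbZ⟩
  · push Not at hSZ
    exact h.le_ncard_cutEdges hloops (Set.disjoint_left.2 hSZ)
      ⟨a, ha.resolve_left fun haS => hSZ a haS haZ, haZ⟩

end SteinerPacking
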